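/- arXiv:1610.02934 — 2 statements merged into one kernel-verified Lean document; each statement's English description precedes it below -/
import Mathlib

section
/- Let T be a triangulation of the completed ∞-gon. Then exactly one of the following holds: (i) T is locally finite, and every arc of T is either peripheral or the generic curve; or (ii) there exist unique vertices a, b ∈ ℤ ∪ {−∞,+∞} such that T has a left fountain at a and a right fountain at b, and moreover either a ≤ b, or a = +∞ and b ∈ ℤ, or a ∈ ℤ and b = −∞. -/
open scoped Classical

/-- Vertices of the completed ∞-gon: `ℤ ∪ {−∞, +∞}` with the extended linear order. -/
abbrev Vtx : Type := WithBot (WithTop ℤ)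

/-- The vertex corresponding to an integer. -/
def vInt (m : ℤ) : Vtx := ((m : WithTop ℤ) : Vtx)

/-- The vertex `+∞`. -/
def vTop : Vtx := ((⊤ : WithTop ℤ) : Vtx)

/-- The vertex `−∞`. -/
def vBot : Vtx := (⊥ : Vtx)

/-- An arc of the completed ∞-gon: a pair of vertices `src < tgt` such that if both
endpoints are integers then they differ by at least `2`. -/
structure Arc where
  src : Vtx
  tgt : Vtx
  lt : src < tgt
  sep : ∀ m n : ℤ, src = vInt m → tgt = vInt n → m + 2 ≤ n

/-- Two arcs `(a,b)` and `(c,d)` cross if `a < c < b < d` or `c < a < d < b`. -/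
def Cross (x y : Arc) : Prop :=
  (x.src < y.src ∧ y.src < x.tgt ∧ x.tgt < y.tgt) ∨
  (y.src < x.src ∧ x.src < y.tgt ∧ y.tgt < x.tgt)

/-- A triangulation of the completed ∞-gon: a maximal set of pairwise compatible
(= non-crossing) arcs. -/
def IsTriangulation (T : Set Arc) : Prop :=
  (∀ x ∈ T, ∀ y ∈ T, ¬ Cross x y) ∧
  ∀ γ : Arc, (∀ x ∈ T, ¬ Cross γ x) → γ ∈ T

lemma vInt_lt_vTop (m : ℤ) : vInt m < vTop := by
  simpa [vInt, vTop] using WithBot.coe_lt_coe.mpr (WithTop.coe_lt_top (m : ℤ))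

lemma vBot_lt_vInt (m : ℤ) : vBot < vInt m := WithBot.bot_lt_coe _

lemma vBot_lt_vTop : vBot < vTop := WithBot.bot_lt_coe _

lemma vTop_ne_vInt (n : ℤ) : vTop ≠ vInt n := by simp [vTop, vInt]

lemma vBot_ne_vInt (n : ℤ) : vBot ≠ vInt n := by simp [vBot, vInt]

/-- The Prüfer curve `π_m = (m, +∞)`. -/
def prufer (m : ℤ) : Arc :=
  ⟨vInt m, vTop, vInt_lt_vTop m, fun _ n _ h => absurd h (vTop_ne_vInt n)⟩

/-- The adic curve `α_m = (−∞, m)`. -/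
def adic (m : ℤ) : Arc :=
  ⟨vBot, vInt m, vBot_lt_vInt m, fun k _ h _ => absurd h (vBot_ne_vInt k)⟩

/-- The generic curve `z = (−∞, +∞)`. -/
def generic : Arc :=
  ⟨vBot, vTop, vBot_lt_vTop, fun k _ h _ => absurd h (vBot_ne_vInt k)⟩

/-- `T` contains an arc with endpoints `x` and `y`. -/
def HasArc (T : Set Arc) (x y : Vtx) : Prop := ∃ γ ∈ T, γ.src = x ∧ γ.tgt = y

/-- `T` has a right fountain at the integer `n`. -/
def RightFountainInt (T : Set Arc) (n : ℤ) : Prop :=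
  {p : ℤ | HasArc T (vInt n) (vInt p)}.Infinite

/-- `T` has a left fountain at the integer `n`. -/
def LeftFountainInt (T : Set Arc) (n : ℤ) : Prop :=
  {p : ℤ | HasArc T (vInt p) (vInt n)}.Infinite

/-- `T` has a right fountain at the vertex `v`. -/
def RightFountain (T : Set Arc) (v : Vtx) : Prop :=
  (∃ n : ℤ, v = vInt n ∧ RightFountainInt T n) ∨
  (v = vTop ∧ {p : ℤ | 0 ≤ p ∧ prufer p ∈ T}.Infinite) ∨
  (v = vBot ∧ {p : ℤ | 0 ≤ p ∧ adic p ∈ T}.Infinite)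

/-- `T` has a left fountain at the vertex `v`. -/
def LeftFountain (T : Set Arc) (v : Vtx) : Prop :=
  (∃ n : ℤ, v = vInt n ∧ LeftFountainInt T n) ∨
  (v = vTop ∧ {p : ℤ | p ≤ 0 ∧ prufer p ∈ T}.Infinite) ∨
  (v = vBot ∧ {p : ℤ | p ≤ 0 ∧ adic p ∈ T}.Infinite)

/-- `T` is locally finite if every vertex is an endpoint of only finitely many arcs of `T`. -/
def LocallyFin (T : Set Arc) : Prop :=
  ∀ v : Vtx, {γ | γ ∈ T ∧ (γ.src = v ∨ γ.tgt = v)}.Finite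

/-- An arc is peripheral if both endpoints are integers. -/
def IsPeripheral (γ : Arc) : Prop :=
  (∃ m : ℤ, γ.src = vInt m) ∧ ∃ n : ℤ, γ.tgt = vInt n

/-- `γ'` is an exchange partner for `γ` relative to `T`:
it is distinct from `γ` and `(T \ {γ}) ∪ {γ'}` is again a triangulation. -/
def MutExchange (T : Set Arc) (γ γ' : Arc) : Prop :=
  γ' ≠ γ ∧ IsTriangulation ((T \ {γ}) ∪ {γ'})

/-- `γ` is a mutable arc of `T`. -/
def IsMutable (T : Set Arc) (γ : Arc) : Prop :=
  γ ∈ T ∧ ∃ γ', MutExchange T γ γ'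

/-- The (unique) replacement arc of `γ` in `T`, when `γ` is mutable. -/
noncomputable def flipArc (T : Set Arc) (γ : Arc) : Arc :=
  if h : ∃ γ', MutExchange T γ γ' then h.choose else γ

/-- The mutation `μ_γ(T)` of `T` at `γ`. -/
noncomputable def mutate (T : Set Arc) (γ : Arc) : Set Arc :=
  (T \ {γ}) ∪ {flipArc T γ}

/-- `μ_γ(δ)`: the effect of the mutation of `T` at `γ` on the arc `δ`. -/
noncomputable def mutArc (T : Set Arc) (γ δ : Arc) : Arc :=
  if δ = γ then flipArc T γ else δ

/-- One step of a mutation sequence on a set of arcs (`none` = no entry). -/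
noncomputable def stepT (T : Set Arc) : Option Arc → Set Arc
  | none => T
  | some γ => mutate T γ

/-- One step of a mutation sequence on a single arc. -/
noncomputable def stepA (T : Set Arc) : Option Arc → Arc → Arc
  | none, δ => δ
  | some γ, δ => mutArc T γ δ

/-- `iterT T θ k` is `μ_{θ_k} ∘ ⋯ ∘ μ_{θ_1}(T)`. Sequences (finite or infinite) are
encoded as `θ : ℕ → Option Arc` whose support is downward closed. -/
noncomputable def iterT (T : Set Arc) (θ : ℕ → Option Arc) : ℕ → Set Arc
  | 0 => T
  | k + 1 => stepT (iterT T θ k) (θ k)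

/-- `iterA T θ γ k` is `μ_{θ_k} ∘ ⋯ ∘ μ_{θ_1}(γ)`. -/
noncomputable def iterA (T : Set Arc) (θ : ℕ → Option Arc) (γ : Arc) : ℕ → Arc
  | 0 => γ
  | k + 1 => stepA (iterT T θ k) (θ k) (iterA T θ γ k)

/-- `θ` is a `T`-admissible sequence: its support is downward closed (so it is a genuine
finite or infinite sequence), each entry is mutable in the triangulation obtained by the
previous mutations, and the mutation of each arc of `T` along `θ` eventually stabilizes. -/
def Admissible (T : Set Arc) (θ : ℕ → Option Arc) : Prop :=
  (∀ i, θ i = none → θ (i + 1) = none) ∧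
  (∀ i γ, θ i = some γ → IsMutable (iterT T θ i) γ) ∧
  (∀ γ ∈ T, ∃ l, ∀ k, l ≤ k → iterA T θ γ k = iterA T θ γ l)

/-- `μ_θ(γ)`: the stable value of the mutation of the arc `γ` along the sequence `θ`. -/
noncomputable def seqLimit (T : Set Arc) (θ : ℕ → Option Arc) (γ : Arc) : Arc :=
  if h : ∃ l, ∀ k, l ≤ k → iterA T θ γ k = iterA T θ γ l
  then iterA T θ γ h.choose else γ

/-- `μ_θ(T)`: the mutation of `T` along the sequence `θ`. -/
noncomputable def mutSeq (T : Set Arc) (θ : ℕ → Option Arc) : Set Arc :=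
  seqLimit T θ '' T

/-- The sequence `θ` leaves the arc `γ` untouched. -/
def Untouched (T : Set Arc) (θ : ℕ → Option Arc) (γ : Arc) : Prop :=
  ∀ l, iterA T θ γ l = γ

/-- The quadrilateral `S(γ)` of a mutable arc `γ` in `T`: with `v₁ < v₂ < v₃ < v₄` the four
endpoints of the two diagonals `γ` and `flipArc T γ`, it consists of those of the pairs
`(v₁,v₂), (v₂,v₃), (v₃,v₄), (v₁,v₄)` that are arcs. -/
noncomputable def quad (T : Set Arc) (γ : Arc) : Set Arc :=
  let γ' := flipArc T γ
  let vs : Vtx × Vtx × Vtx × Vtx :=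
    if γ.src < γ'.src then (γ.src, γ'.src, γ.tgt, γ'.tgt) else (γ'.src, γ.src, γ'.tgt, γ.tgt)
  {δ : Arc | (δ.src = vs.1 ∧ δ.tgt = vs.2.1) ∨ (δ.src = vs.2.1 ∧ δ.tgt = vs.2.2.1) ∨
    (δ.src = vs.2.2.1 ∧ δ.tgt = vs.2.2.2) ∨ (δ.src = vs.1 ∧ δ.tgt = vs.2.2.2)}

/-- The set `𝒫` of Prüfer curves compatible with every arc of `S`. -/
def pruferCompletion (S : Set Arc) : Set Arc :=
  {γ | (∃ k : ℤ, γ = prufer k) ∧ ∀ x ∈ S, ¬ Cross γ x}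

/-- The set `𝒜̃` of adic curves compatible with every arc of `S ∪ 𝒫(S)`. -/
def adicCompletion' (S : Set Arc) : Set Arc :=
  {γ | (∃ k : ℤ, γ = adic k) ∧ ∀ x ∈ S ∪ pruferCompletion S, ¬ Cross γ x}

/-- The completed (Prüfer) mutation `μ̄_θ(T) = μ_θ(T) ∪ 𝒫 ∪ 𝒜̃` of `T` along `θ`. -/
noncomputable def completedMut (T : Set Arc) (θ : ℕ → Option Arc) : Set Arc :=
  mutSeq T θ ∪ pruferCompletion (mutSeq T θ) ∪ adicCompletion' (mutSeq T θ)

/-- The tower of triangulations associated to a composition of completed mutations. -/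
noncomputable def compIter (T : Set Arc) (Θ : ℕ → Option (ℕ → Option Arc)) : ℕ → Set Arc
  | 0 => T
  | k + 1 =>
    match Θ k with
    | none => compIter T Θ k
    | some θ => completedMut (compIter T Θ k) θ

/-- `Θ` is a `T`-admissible composition of completed mutations. -/
def CompAdmissible (T : Set Arc) (Θ : ℕ → Option (ℕ → Option Arc)) : Prop :=
  (∀ i, Θ i = none → Θ (i + 1) = none) ∧
  ∀ i θ, Θ i = some θ → Admissible (compIter T Θ i) θ

/-- The transfinite mutation of `T` along the composition `Θ`. -/
noncomputable def transfiniteMut (T : Set Arc) (Θ : ℕ → Option (ℕ → Option Arc)) : Set Arc :=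
  ⋃ i, {γ ∈ compIter T Θ i |
    ∀ k, i ≤ k → ∀ θ, Θ k = some θ → Untouched (compIter T Θ k) θ γ}

/-- The combinatorics of a triangulation, read off on the integers. -/
structure Sys (P : ℤ → ℤ → Prop) (A Q : ℤ → Prop) : Prop where
  sep : ∀ a b, P a b → a + 2 ≤ b
  pp : ∀ a b c d, P a b → P c d → a < c → c < b → b < d → False
  ap : ∀ m a b, A m → P a b → a < m → m < b → False
  qp : ∀ m a b, Q m → P a b → a < m → m < b → False
  aq : ∀ m n, A m → Q n → n < m → False
  maxA : ∀ m, (∀ a b, P a b → a < m → m < b → False) → (∀ n, Q n → n < m → False) → A m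
  maxQ : ∀ m, (∀ a b, P a b → a < m → m < b → False) → (∀ n, A n → m < n → False) → Q m

theorem Sys.neg {P : ℤ → ℤ → Prop} {A Q : ℤ → Prop} (h : Sys P A Q) :
    Sys (fun a b => P (-b) (-a)) (fun m => Q (-m)) (fun m => A (-m)) where
  sep a b hp := by have := h.sep _ _ hp; omega
  pp a b c d h1 h2 _ _ _ := h.pp _ _ _ _ h2 h1 (by omega) (by omega) (by omega)
  ap m a b h1 h2 _ _ := h.qp _ _ _ h1 h2 (by omega) (by omega)
  qp m a b h1 h2 _ _ := h.ap _ _ _ h1 h2 (by omega) (by omega)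
  aq m n h1 h2 _ := h.aq _ _ h2 h1 (by omega)
  maxA m h1 h2 := h.maxQ _
    (fun a b hp _ _ => h1 (-b) (-a) (by simpa using hp) (by omega) (by omega))
    (fun n hn _ => h2 (-n) (by simpa using hn) (by omega))
  maxQ m h1 h2 := h.maxA _
    (fun a b hp _ _ => h1 (-b) (-a) (by simpa using hp) (by omega) (by omega))
    (fun n hn _ => h2 (-n) (by simpa using hn) (by omega))

/-- Unbounded above. -/
def Unb (S : ℤ → Prop) : Prop := ∀ N, ∃ p, N < p ∧ S p

theorem exists_max {S : ℤ → Prop} (hne : ∃ p, S p) (h : ¬ Unb S) :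
    ∃ m, S m ∧ ∀ p, S p → p ≤ m := by
  unfold Unb at h
  push Not at h
  obtain ⟨N, hN⟩ := h
  refine Int.exists_greatest_of_bdd ⟨N, fun z hz => ?_⟩ hne
  by_contra hc
  exact hN z (by omega) hz

def RF (P : ℤ → ℤ → Prop) (A Q : ℤ → Prop) : Prop :=
  (∃ n, Unb (P n)) ∨ Unb Q ∨ Unb A

theorem reach {P : ℤ → ℤ → Prop} {A Q : ℤ → Prop} (h : Sys P A Q) (n : ℤ)
    (hu : ¬ Unb (P n)) : ∃ q, n < q ∧ (∀ p, P n p → p ≤ q) ∧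
      ∀ c d, n < c → c < q → q < d → P c d → False := by
  by_cases hne : ∃ p, P n p
  · obtain ⟨q, hq, hmax⟩ := exists_max hne hu
    have := h.sep _ _ hq
    exact ⟨q, by omega, hmax, fun c d h1 h2 h3 h4 => h.pp _ _ _ _ hq h4 h1 h2 h3⟩
  · exact ⟨n + 1, by omega, fun p hp => (hne ⟨p, hp⟩).elim, fun c d h1 h2 => by omega⟩

theorem RF_of_Q {P : ℤ → ℤ → Prop} {A Q : ℤ → Prop} (h : Sys P A Q) (hQ : ∃ m, Q m) :
    RF P A Q := by
  by_contra hc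
  unfold RF at hc
  push Not at hc
  obtain ⟨hP, hQu, hA⟩ := hc
  obtain ⟨m, hm, hmax⟩ := exists_max hQ hQu
  obtain ⟨q, hq, h1, h2⟩ := reach h m (hP m)
  have : Q q := by
    refine h.maxQ q (fun a b hp ha hb => ?_) (fun n hn hqn => h.aq _ _ hn hm (by omega))
    rcases lt_trichotomy a m with hlt | rfl | hgt
    · exact h.qp _ _ _ hm hp hlt (by omega)
    · have := h1 _ hp; omega
    · exact h2 _ _ hgt ha hb hp
  have := hmax _ this
  omega

theorem RF_of_A {P : ℤ → ℤ → Prop} {A Q : ℤ → Prop} (h : Sys P A Q) (hA : ∃ m, A m) :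
    RF P A Q := by
  by_cases hQ : ∃ m, Q m
  · exact RF_of_Q h hQ
  by_contra hc
  unfold RF at hc
  push Not at hc hQ
  obtain ⟨hP, hQu, hAu⟩ := hc
  obtain ⟨m, hm, hmax⟩ := exists_max hA hAu
  obtain ⟨q, hq, h1, h2⟩ := reach h m (hP m)
  have : A q := by
    refine h.maxA q (fun a b hp ha hb => ?_) (fun n hn _ => hQ n hn)
    rcases lt_trichotomy a m with hlt | rfl | hgt
    · exact h.ap _ _ _ hm hp hlt (by omega)
    · have := h1 _ hp; omega
    · exact h2 _ _ hgt ha hb hp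
  have := hmax _ this
  omega

theorem RF_of {P : ℤ → ℤ → Prop} {A Q : ℤ → Prop} (h : Sys P A Q)
    (hA : ∃ m, A m ∨ Q m) : RF P A Q := by
  obtain ⟨m, hm | hm⟩ := hA
  · exact RF_of_A h ⟨m, hm⟩
  · exact RF_of_Q h ⟨m, hm⟩

/-- A right fountain at an integer forces an adic or Prüfer curve. -/
theorem AQ_of_unb {P : ℤ → ℤ → Prop} {A Q : ℤ → Prop} (h : Sys P A Q) (n : ℤ)
    (hn : Unb (P n)) : ∃ m, A m ∨ Q m := by
  by_contra hc
  push Not at hc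
  refine (hc n).1 (h.maxA n (fun a b hp ha hb => ?_) (fun k hk _ => (hc k).2 hk))
  obtain ⟨p, hp1, hp2⟩ := hn b
  exact h.pp _ _ _ _ hp hp2 ha hb hp1

theorem uniq_PP {P : ℤ → ℤ → Prop} {A Q : ℤ → Prop} (h : Sys P A Q) (n m : ℤ)
    (hn : Unb (P n)) (hm : Unb (P m)) : n = m := by
  have key : ∀ n m, Unb (P n) → Unb (P m) → n < m → False := by
    intro n m hn hm hlt
    obtain ⟨q, h1, h2⟩ := hn m
    obtain ⟨p, h3, h4⟩ := hm q
    exact h.pp _ _ _ _ h2 h4 hlt h1 h3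
  rcases lt_trichotomy n m with hl | he | hg
  · exact (key _ _ hn hm hl).elim
  · exact he
  · exact (key _ _ hm hn hg).elim

theorem uniq_PQ {P : ℤ → ℤ → Prop} {A Q : ℤ → Prop} (h : Sys P A Q) (n : ℤ)
    (hn : Unb (P n)) (hm : Unb Q) : False := by
  obtain ⟨q, h1, h2⟩ := hm n
  obtain ⟨p, h3, h4⟩ := hn q
  exact h.qp _ _ _ h2 h4 h1 h3

theorem uniq_PA {P : ℤ → ℤ → Prop} {A Q : ℤ → Prop} (h : Sys P A Q) (n : ℤ)
    (hn : Unb (P n)) (hm : Unb A) : False := by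
  obtain ⟨q, h1, h2⟩ := hm n
  obtain ⟨p, h3, h4⟩ := hn q
  exact h.ap _ _ _ h2 h4 h1 h3

theorem uniq_QA {P : ℤ → ℤ → Prop} {A Q : ℤ → Prop} (h : Sys P A Q)
    (hn : Unb Q) (hm : Unb A) : False := by
  obtain ⟨q, h1, h2⟩ := hn 0
  obtain ⟨p, h3, h4⟩ := hm q
  exact h.aq _ _ h4 h2 h3

/-! Translation -/

theorem vInt_lt {a b : ℤ} : vInt a < vInt b ↔ a < b := by simp [vInt]
theorem vInt_inj' {a b : ℤ} : vInt a = vInt b ↔ a = b := by simp [vInt]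

theorem vtx_cases (v : Vtx) : v = vBot ∨ v = vTop ∨ ∃ n, v = vInt n := by
  induction v using WithBot.recBotCoe with
  | bot => exact Or.inl rfl
  | coe w =>
    induction w using WithTop.recTopCoe with
    | top => exact Or.inr (Or.inl rfl)
    | coe n => exact Or.inr (Or.inr ⟨n, rfl⟩)

theorem arc_ext {x y : Arc} (h1 : x.src = y.src) (h2 : x.tgt = y.tgt) : x = y := by
  cases x; cases y; simp_all

theorem le_vTop (v : Vtx) : v ≤ vTop := by
  rcases vtx_cases v with rfl | rfl | ⟨n, rfl⟩
  · exact vBot_lt_vTop.le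
  · exact le_rfl
  · exact (vInt_lt_vTop n).le

theorem vBot_le (v : Vtx) : vBot ≤ v := bot_le

theorem arc_cases (x : Arc) : x = generic ∨ (∃ m, x = adic m) ∨ (∃ m, x = prufer m) ∨
    ∃ a b, x.src = vInt a ∧ x.tgt = vInt b := by
  have hlt := x.lt
  rcases vtx_cases x.src with h1 | h1 | ⟨a, h1⟩ <;> rcases vtx_cases x.tgt with h2 | h2 | ⟨b, h2⟩
  · rw [h1, h2] at hlt; exact (lt_irrefl _ hlt).elim
  · exact Or.inl (arc_ext h1 h2)
  · exact Or.inr (Or.inl ⟨b, arc_ext h1 h2⟩)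
  · exact absurd hlt (not_lt.2 (h1 ▸ le_vTop _))
  · exact absurd hlt (not_lt.2 (h1 ▸ le_vTop _))
  · exact absurd hlt (not_lt.2 (h1 ▸ le_vTop _))
  · exact absurd hlt (not_lt.2 (h2 ▸ vBot_le _))
  · exact Or.inr (Or.inr (Or.inl ⟨a, arc_ext h1 h2⟩))
  · exact Or.inr (Or.inr (Or.inr ⟨a, b, h1, h2⟩))

abbrev PT (T : Set Arc) (a b : ℤ) : Prop := HasArc T (vInt a) (vInt b)
abbrev AT (T : Set Arc) (m : ℤ) : Prop := adic m ∈ T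
abbrev QT (T : Set Arc) (m : ℤ) : Prop := prufer m ∈ T

theorem sysT {T : Set Arc} (hT : IsTriangulation T) : Sys (PT T) (AT T) (QT T) where
  sep := by
    rintro a b ⟨x, _, h1, h2⟩
    exact x.sep a b h1 h2
  pp := by
    rintro a b c d ⟨x, hx, h1, h2⟩ ⟨y, hy, h3, h4⟩ l1 l2 l3
    refine hT.1 x hx y hy (Or.inl ?_)
    rw [h1, h2, h3, h4]
    exact ⟨vInt_lt.2 l1, vInt_lt.2 l2, vInt_lt.2 l3⟩
  ap := by
    rintro m a b hm ⟨x, hx, h1, h2⟩ l1 l2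
    refine hT.1 _ hm x hx (Or.inl ?_)
    rw [h1, h2]
    exact ⟨vBot_lt_vInt a, vInt_lt.2 l1, vInt_lt.2 l2⟩
  qp := by
    rintro m a b hm ⟨x, hx, h1, h2⟩ l1 l2
    refine hT.1 _ hm x hx (Or.inr ?_)
    rw [h1, h2]
    exact ⟨vInt_lt.2 l1, vInt_lt.2 l2, vInt_lt_vTop _⟩
  aq := by
    intro m n hm hn l
    exact hT.1 _ hm _ hn (Or.inl ⟨vBot_lt_vInt _, vInt_lt.2 l, vInt_lt_vTop _⟩)
  maxA := by
    intro m h1 h2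
    refine hT.2 _ (fun x hx hc => ?_)
    have hc' : vBot < x.src ∧ x.src < vInt m ∧ vInt m < x.tgt := by
      rcases hc with hc | hc
      · exact hc
      · exact absurd hc.1 (not_lt.2 (vBot_le _))
    obtain ⟨c1, c2, c3⟩ := hc'
    rcases arc_cases x with rfl | ⟨k, rfl⟩ | ⟨k, rfl⟩ | ⟨a, b, ha, hb⟩
    · exact lt_irrefl _ c1
    · exact lt_irrefl _ c1
    · exact h2 k hx (vInt_lt.1 c2)
    · rw [ha] at c2; rw [hb] at c3
      exact h1 a b ⟨x, hx, ha, hb⟩ (vInt_lt.1 c2) (vInt_lt.1 c3)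
  maxQ := by
    intro m h1 h2
    refine hT.2 _ (fun x hx hc => ?_)
    have hc' : x.src < vInt m ∧ vInt m < x.tgt ∧ x.tgt < vTop := by
      rcases hc with hc | hc
      · exact absurd hc.2.2 (not_lt.2 (le_vTop _))
      · exact hc
    obtain ⟨c1, c2, c3⟩ := hc'
    rcases arc_cases x with rfl | ⟨k, rfl⟩ | ⟨k, rfl⟩ | ⟨a, b, ha, hb⟩
    · exact lt_irrefl _ c3
    · exact h2 k hx (vInt_lt.1 c2)
    · exact lt_irrefl _ c3
    · rw [ha] at c1; rw [hb] at c2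
      exact h1 a b ⟨x, hx, ha, hb⟩ (vInt_lt.1 c1) (vInt_lt.1 c2)

theorem inf_iff_unb {S : ℤ → Prop} (k : ℤ) : {p | k ≤ p ∧ S p}.Infinite ↔ Unb S := by
  constructor
  · intro h N
    by_contra hc
    push Not at hc
    refine h ((Set.finite_Icc k N).subset ?_)
    rintro p ⟨h1, h2⟩
    exact ⟨h1, not_lt.1 (fun hlt => hc p hlt h2)⟩
  · intro h hf
    obtain ⟨M, hM⟩ := hf.bddAbove
    obtain ⟨p, h1, h2⟩ := h (max M k)
    have := hM (show p ∈ {p | k ≤ p ∧ S p} from ⟨by omega, h2⟩)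
    omega

theorem inf_iff_unb_neg {S : ℤ → Prop} (k : ℤ) :
    {p | p ≤ k ∧ S p}.Infinite ↔ Unb (fun p => S (-p)) := by
  rw [← inf_iff_unb (-k)]
  have : {p | -k ≤ p ∧ S (-p)} = Neg.neg '' {p | p ≤ k ∧ S p} := by
    ext p
    simp only [Set.mem_setOf_eq, Set.mem_image]
    constructor
    · rintro ⟨h1, h2⟩
      exact ⟨-p, ⟨by omega, h2⟩, by simp⟩
    · rintro ⟨q, ⟨h1, h2⟩, rfl⟩
      exact ⟨by omega, by simpa using h2⟩
  rw [this, Set.infinite_image_iff (neg_injective.injOn)]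

theorem right_int_iff {T : Set Arc} (hT : IsTriangulation T) (n : ℤ) :
    RightFountainInt T n ↔ Unb (PT T n) := by
  rw [← inf_iff_unb n]
  unfold RightFountainInt
  have : {p : ℤ | HasArc T (vInt n) (vInt p)} = {p | n ≤ p ∧ PT T n p} := by
    ext p
    simp only [Set.mem_setOf_eq]
    refine ⟨fun h => ⟨?_, h⟩, fun h => h.2⟩
    have := (sysT hT).sep _ _ h
    omega
  rw [this]

theorem left_int_iff {T : Set Arc} (hT : IsTriangulation T) (n : ℤ) :
    LeftFountainInt T n ↔ Unb (fun p => PT T (-p) n) := by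
  rw [← inf_iff_unb_neg (S := fun p => PT T p n) n]
  unfold LeftFountainInt
  have : {p : ℤ | HasArc T (vInt p) (vInt n)} = {p | p ≤ n ∧ PT T p n} := by
    ext p
    simp only [Set.mem_setOf_eq]
    refine ⟨fun h => ⟨?_, h⟩, fun h => h.2⟩
    have := (sysT hT).sep _ _ h
    omega
  rw [this]

theorem right_iff {T : Set Arc} (hT : IsTriangulation T) (v : Vtx) :
    RightFountain T v ↔ (∃ n, v = vInt n ∧ Unb (PT T n)) ∨ (v = vTop ∧ Unb (QT T)) ∨
      (v = vBot ∧ Unb (AT T)) := by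
  unfold RightFountain
  simp only [right_int_iff hT, inf_iff_unb]

theorem left_iff {T : Set Arc} (hT : IsTriangulation T) (v : Vtx) :
    LeftFountain T v ↔ (∃ n, v = vInt n ∧ Unb (fun p => PT T (-p) n)) ∨
      (v = vTop ∧ Unb (fun p => QT T (-p))) ∨ (v = vBot ∧ Unb (fun p => AT T (-p))) := by
  unfold LeftFountain
  simp only [left_int_iff hT]
  rw [inf_iff_unb_neg (S := fun p => prufer p ∈ T), inf_iff_unb_neg (S := fun p => adic p ∈ T)]

theorem right_unique {T : Set Arc} (hT : IsTriangulation T) {v w : Vtx}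
    (hv : RightFountain T v) (hw : RightFountain T w) : v = w := by
  have h := sysT hT
  rw [right_iff hT] at hv hw
  rcases hv with ⟨n, rfl, h1⟩ | ⟨rfl, h1⟩ | ⟨rfl, h1⟩ <;>
    rcases hw with ⟨m, rfl, h2⟩ | ⟨rfl, h2⟩ | ⟨rfl, h2⟩
  · rw [uniq_PP h n m h1 h2]
  · exact (uniq_PQ h _ h1 h2).elim
  · exact (uniq_PA h _ h1 h2).elim
  · exact (uniq_PQ h _ h2 h1).elim
  · rfl
  · exact (uniq_QA h h1 h2).elim
  · exact (uniq_PA h _ h2 h1).elim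
  · exact (uniq_QA h h2 h1).elim
  · rfl

theorem left_unique {T : Set Arc} (hT : IsTriangulation T) {v w : Vtx}
    (hv : LeftFountain T v) (hw : LeftFountain T w) : v = w := by
  have h := (sysT hT).neg
  have cv : ∀ n, Unb (fun p => PT T (-p) n) → Unb (fun p => PT T (-p) (-(-n))) := by
    intro n hn; simpa using hn
  rw [left_iff hT] at hv hw
  rcases hv with ⟨n, rfl, h1⟩ | ⟨rfl, h1⟩ | ⟨rfl, h1⟩ <;>
    rcases hw with ⟨m, rfl, h2⟩ | ⟨rfl, h2⟩ | ⟨rfl, h2⟩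
  · have := uniq_PP h (-n) (-m) (cv _ h1) (cv _ h2)
    rw [neg_injective this]
  · exact (uniq_PA h (-n) (cv _ h1) h2).elim
  · exact (uniq_PQ h (-n) (cv _ h1) h2).elim
  · exact (uniq_PA h (-m) (cv _ h2) h1).elim
  · rfl
  · exact (uniq_QA h h2 h1).elim
  · exact (uniq_PQ h (-m) (cv _ h2) h1).elim
  · exact (uniq_QA h h1 h2).elim
  · rfl

theorem right_exists {T : Set Arc} (hT : IsTriangulation T) (hA : ∃ m, AT T m ∨ QT T m) :
    ∃ v, RightFountain T v := by
  simp only [right_iff hT]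
  rcases RF_of (sysT hT) hA with ⟨n, hn⟩ | hn | hn
  · exact ⟨_, Or.inl ⟨n, rfl, hn⟩⟩
  · exact ⟨_, Or.inr (Or.inl ⟨rfl, hn⟩)⟩
  · exact ⟨_, Or.inr (Or.inr ⟨rfl, hn⟩)⟩

theorem left_exists {T : Set Arc} (hT : IsTriangulation T) (hA : ∃ m, AT T m ∨ QT T m) :
    ∃ v, LeftFountain T v := by
  simp only [left_iff hT]
  obtain ⟨m, hm⟩ := hA
  rcases RF_of (sysT hT).neg ⟨-m, by simpa using hm.symm⟩ with ⟨n, hn⟩ | hn | hn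
  · exact ⟨_, Or.inl ⟨-n, rfl, hn⟩⟩
  · exact ⟨_, Or.inr (Or.inr ⟨rfl, hn⟩)⟩
  · exact ⟨_, Or.inr (Or.inl ⟨rfl, hn⟩)⟩

theorem position {T : Set Arc} (hT : IsTriangulation T) {a b : Vtx}
    (ha : LeftFountain T a) (hb : RightFountain T b) :
    a ≤ b ∨ (a = vTop ∧ ∃ n : ℤ, b = vInt n) ∨ ((∃ n : ℤ, a = vInt n) ∧ b = vBot) := by
  have h := sysT hT
  rw [left_iff hT] at ha
  rw [right_iff hT] at hb
  rcases ha with ⟨n, rfl, h1⟩ | ⟨rfl, h1⟩ | ⟨rfl, h1⟩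
  · rcases hb with ⟨m, rfl, h2⟩ | ⟨rfl, h2⟩ | ⟨rfl, h2⟩
    · left
      by_contra hc
      have hlt : m < n := vInt_lt.1 (not_le.1 hc)
      obtain ⟨p, hp1, hp2⟩ := h1 (-m)
      obtain ⟨q, hq1, hq2⟩ := h2 n
      exact h.pp _ _ _ _ hp2 hq2 (by omega) hlt hq1
    · exact Or.inl (le_vTop _)
    · exact Or.inr (Or.inr ⟨⟨n, rfl⟩, rfl⟩)
  · rcases hb with ⟨m, rfl, h2⟩ | ⟨rfl, h2⟩ | ⟨rfl, h2⟩
    · exact Or.inr (Or.inl ⟨rfl, m, rfl⟩)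
    · exact Or.inl le_rfl
    · obtain ⟨p, hp1, hp2⟩ := h1 0
      obtain ⟨q, hq1, hq2⟩ := h2 0
      exact (h.aq _ _ hq2 hp2 (by omega)).elim
  · exact Or.inl (vBot_le _)

theorem AQ_of_right {T : Set Arc} (hT : IsTriangulation T) {v : Vtx}
    (hv : RightFountain T v) : ∃ m, AT T m ∨ QT T m := by
  rw [right_iff hT] at hv
  rcases hv with ⟨n, rfl, h1⟩ | ⟨rfl, h1⟩ | ⟨rfl, h1⟩
  · exact AQ_of_unb (sysT hT) n h1
  · obtain ⟨p, _, hp⟩ := h1 0; exact ⟨p, Or.inr hp⟩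
  · obtain ⟨p, _, hp⟩ := h1 0; exact ⟨p, Or.inl hp⟩

theorem AQ_of_left {T : Set Arc} (hT : IsTriangulation T) {v : Vtx}
    (hv : LeftFountain T v) : ∃ m, AT T m ∨ QT T m := by
  rw [left_iff hT] at hv
  rcases hv with ⟨n, rfl, h1⟩ | ⟨rfl, h1⟩ | ⟨rfl, h1⟩
  · obtain ⟨m, hm⟩ := AQ_of_unb (sysT hT).neg (-n) (by simpa using h1)
    exact ⟨-m, hm.symm⟩
  · obtain ⟨p, _, hp⟩ := h1 0; exact ⟨_, Or.inr hp⟩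
  · obtain ⟨p, _, hp⟩ := h1 0; exact ⟨_, Or.inl hp⟩

/-- Without adic and Prüfer curves, `T` is locally finite. -/
theorem locFin_of {T : Set Arc} (hT : IsTriangulation T) (hA : ¬ ∃ m, AT T m ∨ QT T m) :
    LocallyFin T ∧ ∀ γ ∈ T, IsPeripheral γ ∨ γ = generic := by
  have key : ∀ γ ∈ T, γ = generic ∨ ∃ a b, γ.src = vInt a ∧ γ.tgt = vInt b := by
    intro x hx
    rcases arc_cases x with h | ⟨k, rfl⟩ | ⟨k, rfl⟩ | h
    · exact Or.inl h
    · exact (hA ⟨k, Or.inl hx⟩).elim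
    · exact (hA ⟨k, Or.inr hx⟩).elim
    · exact Or.inr h
  refine ⟨fun v => ?_, fun x hx => ?_⟩
  · rcases vtx_cases v with hv | hv | ⟨n, rfl⟩
    · refine (Set.finite_singleton generic).subset ?_
      rintro x ⟨hx, hxv⟩
      rcases key x hx with h | ⟨a, b, h1, h2⟩
      · exact h
      · rw [h1, h2, hv] at hxv
        rcases hxv with h | h
        · exact (vBot_ne_vInt _ h.symm).elim
        · exact (vBot_ne_vInt _ h.symm).elim
    · refine (Set.finite_singleton generic).subset ?_
      rintro x ⟨hx, hxv⟩
      rcases key x hx with h | ⟨a, b, h1, h2⟩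
      · exact h
      · rw [h1, h2, hv] at hxv
        rcases hxv with h | h
        · exact (vTop_ne_vInt _ h.symm).elim
        · exact (vTop_ne_vInt _ h.symm).elim
    · have hR : {p : ℤ | HasArc T (vInt n) (vInt p)}.Finite := by
        by_contra hc
        exact hA (AQ_of_right hT (v := vInt n) (Or.inl ⟨n, rfl, hc⟩))
      have hL : {p : ℤ | HasArc T (vInt p) (vInt n)}.Finite := by
        by_contra hc
        exact hA (AQ_of_left hT (v := vInt n) (Or.inl ⟨n, rfl, hc⟩))
      have hf : Set.Finite (((fun p => (vInt n, vInt p)) '' {p : ℤ | HasArc T (vInt n) (vInt p)}) ∪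
          ((fun p => (vInt p, vInt n)) '' {p : ℤ | HasArc T (vInt p) (vInt n)})) :=
        (hR.image _).union (hL.image _)
      refine Set.Finite.of_finite_image (f := fun x : Arc => (x.src, x.tgt)) (hf.subset ?_) ?_
      · rintro _ ⟨x, ⟨hx, hxv⟩, rfl⟩
        rcases key x hx with rfl | ⟨a, b, h1, h2⟩
        · rcases hxv with h | h
          · exact (vBot_ne_vInt _ h).elim
          · exact (vTop_ne_vInt _ h).elim
        · rcases hxv with h | h
          · exact Or.inl ⟨b, ⟨x, hx, h, h2⟩, by simp [h, h2]⟩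
          · exact Or.inr ⟨a, ⟨x, hx, h1, h⟩, by simp [h, h1]⟩
      · intro x _ y _ hxy
        simp only [Prod.mk.injEq] at hxy
        exact arc_ext hxy.1 hxy.2
  · rcases key x hx with h | ⟨a, b, h1, h2⟩
    · exact Or.inr h
    · exact Or.inl ⟨⟨a, h1⟩, b, h2⟩

theorem not_AQ_of {T : Set Arc} (h : ∀ γ ∈ T, IsPeripheral γ ∨ γ = generic) :
    ¬ ∃ m, AT T m ∨ QT T m := by
  rintro ⟨m, hm | hm⟩
  · rcases h _ hm with ⟨⟨k, hk⟩, _⟩ | h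
    · exact vBot_ne_vInt _ hk
    · exact vTop_ne_vInt m (congrArg Arc.tgt h).symm
  · rcases h _ hm with ⟨_, ⟨k, hk⟩⟩ | h
    · exact vTop_ne_vInt _ hk
    · exact vBot_ne_vInt m (congrArg Arc.src h).symm

/-- Theorem (classification of triangulations of the completed ∞-gon):
exactly one of the following holds: (i) `T` is locally finite and every arc of `T` is
peripheral or the generic curve; (ii) `T` has a left fountain at a unique vertex `a` and a
right fountain at a unique vertex `b`, where `a ≤ b`, or `a = +∞` and `b ∈ ℤ`, or `a ∈ ℤ`
and `b = −∞`. -/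
theorem statement0 (T : Set Arc) (hT : IsTriangulation T) :
    Xor'
      (LocallyFin T ∧ ∀ γ ∈ T, IsPeripheral γ ∨ γ = generic)
      (∃ a b : Vtx, LeftFountain T a ∧ RightFountain T b ∧
        (∀ a', LeftFountain T a' → a' = a) ∧ (∀ b', RightFountain T b' → b' = b) ∧
        (a ≤ b ∨ (a = vTop ∧ ∃ n : ℤ, b = vInt n) ∨ ((∃ n : ℤ, a = vInt n) ∧ b = vBot))) := by
  by_cases hA : ∃ m, AT T m ∨ QT T m
  · right
    obtain ⟨a, ha⟩ := left_exists hT hA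
    obtain ⟨b, hb⟩ := right_exists hT hA
    refine ⟨⟨a, b, ha, hb, fun a' ha' => left_unique hT ha' ha,
      fun b' hb' => right_unique hT hb' hb, position hT ha hb⟩, fun h => ?_⟩
    exact not_AQ_of h.2 hA
  · left
    refine ⟨locFin_of hT hA, ?_⟩
    rintro ⟨a, b, ha, _⟩
    exact hA (AQ_of_left hT ha)
end

section
/- Let T be a triangulation of the ∞-gon and let θ = (a,b) ∈ T. Then θ is mutable in T if and only if it is not the case that T has both a left fountain at a and a right fountain at b. -/
open scoped Classical

/-- An arc of the ∞-gon: a pair of integers `(i,j)` with `i ≤ j − 2`. -/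
structure ArcZ where
  src : ℤ
  tgt : ℤ
  sep : src + 2 ≤ tgt

/-- Two arcs `(i,j)` and `(k,l)` cross if `i < k < j < l` or `k < i < l < j`. -/
def CrossZ (x y : ArcZ) : Prop :=
  (x.src < y.src ∧ y.src < x.tgt ∧ x.tgt < y.tgt) ∨
  (y.src < x.src ∧ x.src < y.tgt ∧ y.tgt < x.tgt)

/-- A triangulation of the ∞-gon: a maximal set of pairwise compatible
(= non-crossing) arcs. -/
def IsTriangulationZ (T : Set ArcZ) : Prop :=
  (∀ x ∈ T, ∀ y ∈ T, ¬ CrossZ x y) ∧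
  ∀ γ : ArcZ, (∀ x ∈ T, ¬ CrossZ γ x) → γ ∈ T

/-- `T` has a right fountain at `n`. -/
def RightFountainZ (T : Set ArcZ) (n : ℤ) : Prop :=
  {p : ℤ | ∃ γ ∈ T, γ.src = n ∧ γ.tgt = p}.Infinite

/-- `T` has a left fountain at `n`. -/
def LeftFountainZ (T : Set ArcZ) (n : ℤ) : Prop :=
  {p : ℤ | ∃ γ ∈ T, γ.src = p ∧ γ.tgt = n}.Infinite

/-- `T` is locally finite if every integer is an endpoint of only finitely many arcs of `T`. -/
def LocallyFinZ (T : Set ArcZ) : Prop :=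
  ∀ v : ℤ, {γ | γ ∈ T ∧ (γ.src = v ∨ γ.tgt = v)}.Finite

/-- `γ'` is an exchange partner for `γ` relative to `T`:
it is distinct from `γ` and `(T \ {γ}) ∪ {γ'}` is again a triangulation. -/
def MutExchangeZ (T : Set ArcZ) (γ γ' : ArcZ) : Prop :=
  γ' ≠ γ ∧ IsTriangulationZ ((T \ {γ}) ∪ {γ'})

/-- `γ` is a mutable arc of `T`. -/
def IsMutableZ (T : Set ArcZ) (γ : ArcZ) : Prop :=
  γ ∈ T ∧ ∃ γ', MutExchangeZ T γ γ'

/-- The (unique) replacement arc of `γ` in `T`, when `γ` is mutable. -/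
noncomputable def flipArcZ (T : Set ArcZ) (γ : ArcZ) : ArcZ :=
  if h : ∃ γ', MutExchangeZ T γ γ' then h.choose else γ

/-- The mutation `μ_γ(T)` of `T` at `γ`. -/
noncomputable def mutateZ (T : Set ArcZ) (γ : ArcZ) : Set ArcZ :=
  (T \ {γ}) ∪ {flipArcZ T γ}

/-- `μ_γ(δ)`: the effect of the mutation of `T` at `γ` on the arc `δ`. -/
noncomputable def mutArcZ (T : Set ArcZ) (γ δ : ArcZ) : ArcZ :=
  if δ = γ then flipArcZ T γ else δ

/-- One step of a mutation sequence on a set of arcs (`none` = no entry). -/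
noncomputable def stepTZ (T : Set ArcZ) : Option ArcZ → Set ArcZ
  | none => T
  | some γ => mutateZ T γ

/-- One step of a mutation sequence on a single arc. -/
noncomputable def stepAZ (T : Set ArcZ) : Option ArcZ → ArcZ → ArcZ
  | none, δ => δ
  | some γ, δ => mutArcZ T γ δ

/-- `iterTZ T θ k` is `μ_{θ_k} ∘ ⋯ ∘ μ_{θ_1}(T)`. Sequences (finite or infinite) are
encoded as `θ : ℕ → Option ArcZ` whose support is downward closed. -/
noncomputable def iterTZ (T : Set ArcZ) (θ : ℕ → Option ArcZ) : ℕ → Set ArcZ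
  | 0 => T
  | k + 1 => stepTZ (iterTZ T θ k) (θ k)

/-- `iterAZ T θ γ k` is `μ_{θ_k} ∘ ⋯ ∘ μ_{θ_1}(γ)`. -/
noncomputable def iterAZ (T : Set ArcZ) (θ : ℕ → Option ArcZ) (γ : ArcZ) : ℕ → ArcZ
  | 0 => γ
  | k + 1 => stepAZ (iterTZ T θ k) (θ k) (iterAZ T θ γ k)

/-- `θ` is a `T`-admissible sequence: its support is downward closed (so it is a genuine
finite or infinite sequence), each entry is mutable in the triangulation obtained by the
previous mutations, and the mutation of each arc of `T` along `θ` eventually stabilizes. -/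
def AdmissibleZ (T : Set ArcZ) (θ : ℕ → Option ArcZ) : Prop :=
  (∀ i, θ i = none → θ (i + 1) = none) ∧
  (∀ i γ, θ i = some γ → IsMutableZ (iterTZ T θ i) γ) ∧
  (∀ γ ∈ T, ∃ l, ∀ k, l ≤ k → iterAZ T θ γ k = iterAZ T θ γ l)

/-- `μ_θ(γ)`: the stable value of the mutation of the arc `γ` along the sequence `θ`. -/
noncomputable def seqLimitZ (T : Set ArcZ) (θ : ℕ → Option ArcZ) (γ : ArcZ) : ArcZ :=
  if h : ∃ l, ∀ k, l ≤ k → iterAZ T θ γ k = iterAZ T θ γ l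
  then iterAZ T θ γ h.choose else γ

/-- `μ_θ(T)`: the mutation of `T` along the sequence `θ`. -/
noncomputable def mutSeqZ (T : Set ArcZ) (θ : ℕ → Option ArcZ) : Set ArcZ :=
  seqLimitZ T θ '' T

/-- The sequence `θ` leaves the arc `γ` untouched. -/
def UntouchedZ (T : Set ArcZ) (θ : ℕ → Option ArcZ) (γ : ArcZ) : Prop :=
  ∀ l, iterAZ T θ γ l = γ

/-- The quadrilateral `S(γ)` of a mutable arc `γ` in `T`: with `v₁ < v₂ < v₃ < v₄` the four
endpoints of the two diagonals `γ` and `flipArcZ T γ`, it consists of those of the pairs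
`(v₁,v₂), (v₂,v₃), (v₃,v₄), (v₁,v₄)` that are arcs. -/
noncomputable def quadZ (T : Set ArcZ) (γ : ArcZ) : Set ArcZ :=
  let γ' := flipArcZ T γ
  let vs : ℤ × ℤ × ℤ × ℤ :=
    if γ.src < γ'.src then (γ.src, γ'.src, γ.tgt, γ'.tgt) else (γ'.src, γ.src, γ'.tgt, γ.tgt)
  {δ : ArcZ | (δ.src = vs.1 ∧ δ.tgt = vs.2.1) ∨ (δ.src = vs.2.1 ∧ δ.tgt = vs.2.2.1) ∨
    (δ.src = vs.2.2.1 ∧ δ.tgt = vs.2.2.2) ∨ (δ.src = vs.1 ∧ δ.tgt = vs.2.2.2)}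

/-- The restriction `T|_S` of a set of arcs to a set `S` of vertices. -/
def restrictZ (T : Set ArcZ) (S : Set ℤ) : Set ArcZ :=
  {γ | γ ∈ T ∧ γ.src ∈ S ∧ γ.tgt ∈ S}

/-- `T ≤_s T'`: there is a `T`-admissible sequence `θ` with `μ_θ(T) = T'`. -/
def leS (T T' : Set ArcZ) : Prop :=
  ∃ θ : ℕ → Option ArcZ, AdmissibleZ T θ ∧ mutSeqZ T θ = T'

/-- `(i,j)` is an edge or an arc which crosses no arc of `T`. -/
def NZ (T : Set ArcZ) (i j : ℤ) : Prop :=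
  i < j ∧ ∀ x ∈ T, ¬ ((i < x.src ∧ x.src < j ∧ j < x.tgt) ∨ (x.src < i ∧ i < x.tgt ∧ x.tgt < j))

lemma NZ_succ (T : Set ArcZ) (i : ℤ) : NZ T i (i + 1) :=
  ⟨by omega, fun x _ => by omega⟩

lemma NZ_of_mem {T : Set ArcZ} (hT : IsTriangulationZ T) {x : ArcZ} (hx : x ∈ T) :
    NZ T x.src x.tgt :=
  ⟨by have := x.sep; omega, fun y hy => hT.1 x hx y hy⟩

lemma NZ_mem {T : Set ArcZ} (hT : IsTriangulationZ T) {i j : ℤ} (h : NZ T i j)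
    (hij : i + 2 ≤ j) : (⟨i, j, hij⟩ : ArcZ) ∈ T :=
  hT.2 _ h.2

/-- sides distinct from `θ` are not crossed by arcs compatible with `T \ {θ}` -/
lemma NZ_compat {T : Set ArcZ} (hT : IsTriangulationZ T) {θ δ : ArcZ}
    (hδ : ∀ x ∈ T, x ≠ θ → ¬ CrossZ δ x) {i j : ℤ} (h : NZ T i j)
    (hne : i ≠ θ.src ∨ j ≠ θ.tgt) :
    ¬ ((i < δ.src ∧ δ.src < j ∧ j < δ.tgt) ∨ (δ.src < i ∧ i < δ.tgt ∧ δ.tgt < j)) := by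
  by_cases hij : i + 2 ≤ j
  · have := hδ _ (NZ_mem hT h hij) (by rintro rfl; simp at hne)
    simp only [CrossZ] at this
    omega
  · have := h.1
    omega

lemma ArcZ_eq {x y : ArcZ} (h1 : x.src = y.src) (h2 : x.tgt = y.tgt) : x = y := by
  cases x; cases y; simp_all

lemma mut_of {T : Set ArcZ} (hT : IsTriangulationZ T) {θ γ : ArcZ} (hθ : θ ∈ T)
    (hc : CrossZ γ θ) (h1 : ∀ x ∈ T, CrossZ γ x → x = θ)
    (h2 : ∀ δ, CrossZ δ θ → (∀ x ∈ T, x ≠ θ → ¬ CrossZ δ x) → ¬ CrossZ δ γ → δ = γ) :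
    IsMutableZ T θ := by
  have symm : ∀ x y, CrossZ x y → CrossZ y x := by
    intro x y h
    simp only [CrossZ] at *
    omega
  have irr : ∀ x, ¬ CrossZ x x := by
    intro x h
    simp only [CrossZ] at h
    omega
  refine ⟨hθ, γ, ?_, ?_, ?_⟩
  · rintro rfl
    exact irr _ hc
  · rintro x (⟨hx, hx'⟩ | rfl) y (⟨hy, hy'⟩ | rfl) h
    · exact hT.1 x hx y hy h
    · exact hx' (h1 x hx (symm _ _ h))
    · exact hy' (h1 y hy h)
    · exact irr _ h
  · intro δ hδ
    have hδ' : ∀ x ∈ T, x ≠ θ → ¬ CrossZ δ x := fun x hx hne => hδ x (Or.inl ⟨hx, hne⟩)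
    have hδγ : ¬ CrossZ δ γ := hδ γ (Or.inr rfl)
    by_cases hcr : CrossZ δ θ
    · exact Or.inr (h2 δ hcr hδ' hδγ)
    · left
      refine ⟨hT.2 δ fun x hx => ?_, ?_⟩
      · by_cases hxe : x = θ
        · rw [hxe]; exact hcr
        · exact hδ' x hx hxe
      · rintro rfl
        exact hδγ (symm _ _ hc)

lemma inner_vertex {T : Set ArcZ} (hT : IsTriangulationZ T) {θ : ArcZ} (hθ : θ ∈ T) :
    ∃ v, NZ T θ.src v ∧ NZ T v θ.tgt := by
  have hs := θ.sep
  obtain ⟨v, ⟨hv, hvb⟩, hmax⟩ := Int.exists_greatest_of_bdd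
    (P := fun v => NZ T θ.src v ∧ v < θ.tgt) ⟨θ.tgt, fun z hz => hz.2.le⟩
    ⟨θ.src + 1, NZ_succ _ _, by omega⟩
  refine ⟨v, hv, hvb, fun x hx hc => ?_⟩
  have h1 := (NZ_of_mem hT hθ).2 x hx
  have h2 := hv.2 x hx
  have h3 := hv.1
  have h4 := hmax x.tgt
  have h5 := NZ_of_mem hT hx
  have h6 : x.src = θ.src := by omega
  rw [h6] at h5
  have h7 := h4 ⟨h5, by omega⟩
  omega

lemma outer_right {T : Set ArcZ} (hT : IsTriangulationZ T) {a b : ℤ} (hab : NZ T a b)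
    (hF : ¬ RightFountainZ T b) :
    (∃ w, NZ T b w ∧ NZ T a w) ∨ (∃ w, NZ T w a ∧ NZ T w b) := by
  rw [RightFountainZ, Set.not_infinite] at hF
  obtain ⟨M, hM⟩ := hF.bddAbove
  obtain ⟨w, hw, hmax⟩ := Int.exists_greatest_of_bdd (P := fun w => NZ T b w)
    ⟨max M (b + 1), fun z hz => by
      by_cases h : b + 2 ≤ z
      · exact le_max_of_le_left (hM ⟨_, NZ_mem hT hz h, rfl, rfl⟩)
      · exact le_max_of_le_right (by omega)⟩ ⟨b + 1, NZ_succ _ _⟩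
  have hab1 := hab.1
  have hw1 := hw.1
  by_cases haw : NZ T a w
  · exact Or.inl ⟨w, hw, haw⟩
  right
  have : ∃ x ∈ T, (a < x.src ∧ x.src < w ∧ w < x.tgt) ∨ (x.src < a ∧ a < x.tgt ∧ x.tgt < w) := by
    by_contra hcon
    exact haw ⟨by omega, fun x hx hc => hcon ⟨x, hx, hc⟩⟩
  obtain ⟨x, hx, hc⟩ := this
  have h1 := hab.2 x hx
  have h2 := hw.2 x hx
  have h5 := NZ_of_mem hT hx
  have hk : NZ T x.src b ∧ x.src < a := by
    rcases hc with hc | hc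
    · have h6 : x.src = b := by omega
      rw [h6] at h5
      have := hmax _ h5
      omega
    · have h6 : x.tgt = b := by omega
      rw [h6] at h5
      exact ⟨h5, hc.1⟩
  obtain ⟨k, ⟨hkb, hka⟩, hkmax⟩ := Int.exists_greatest_of_bdd
    (P := fun k => NZ T k b ∧ k < a) ⟨a, fun z hz => hz.2.le⟩ ⟨_, hk⟩
  refine ⟨k, ⟨hka, fun y hy hcy => ?_⟩, hkb⟩
  have g1 := hkb.2 y hy
  have g2 := hab.2 y hy
  have g3 : y.tgt = b := by omega
  have g5 := NZ_of_mem hT hy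
  rw [g3] at g5
  have := hkmax _ ⟨g5, by omega⟩
  omega

lemma outer_left {T : Set ArcZ} (hT : IsTriangulationZ T) {a b : ℤ} (hab : NZ T a b)
    (hF : ¬ LeftFountainZ T a) :
    (∃ w, NZ T b w ∧ NZ T a w) ∨ (∃ w, NZ T w a ∧ NZ T w b) := by
  rw [LeftFountainZ, Set.not_infinite] at hF
  obtain ⟨M, hM⟩ := hF.bddBelow
  obtain ⟨w, hw, hmin⟩ := Int.exists_least_of_bdd (P := fun w => NZ T w a)
    ⟨min M (a - 1), fun z hz => by
      by_cases h : z + 2 ≤ a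
      · exact min_le_of_left_le (hM ⟨_, NZ_mem hT hz h, rfl, rfl⟩)
      · exact min_le_of_right_le (by omega)⟩ ⟨a - 1, by simpa using NZ_succ T (a - 1)⟩
  have hab1 := hab.1
  have hw1 := hw.1
  by_cases haw : NZ T w b
  · exact Or.inr ⟨w, hw, haw⟩
  left
  have : ∃ x ∈ T, (w < x.src ∧ x.src < b ∧ b < x.tgt) ∨ (x.src < w ∧ w < x.tgt ∧ x.tgt < b) := by
    by_contra hcon
    exact haw ⟨by omega, fun x hx hc => hcon ⟨x, hx, hc⟩⟩
  obtain ⟨x, hx, hc⟩ := this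
  have h1 := hab.2 x hx
  have h2 := hw.2 x hx
  have h5 := NZ_of_mem hT hx
  have hk : NZ T a x.tgt ∧ b < x.tgt := by
    rcases hc with hc | hc
    · have h6 : x.src = a := by omega
      rw [h6] at h5
      exact ⟨h5, hc.2.2⟩
    · have h6 : x.tgt = a := by omega
      rw [h6] at h5
      have := hmin _ h5
      omega
  obtain ⟨k, ⟨hka, hkb⟩, hkmin⟩ := Int.exists_least_of_bdd
    (P := fun k => NZ T a k ∧ b < k) ⟨b, fun z hz => hz.2.le⟩ ⟨_, hk⟩
  refine ⟨k, ⟨hkb, fun y hy hcy => ?_⟩, hka⟩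
  have g1 := hka.2 y hy
  have g2 := hab.2 y hy
  have g3 : y.src = a := by omega
  have g5 := NZ_of_mem hT hy
  rw [g3] at g5
  have := hkmin _ ⟨g5, by omega⟩
  omega

lemma not_mutable {T : Set ArcZ} (hT : IsTriangulationZ T) {θ : ArcZ} (hθ : θ ∈ T)
    (hm : IsMutableZ T θ) (hL : LeftFountainZ T θ.src) (hR : RightFountainZ T θ.tgt) : False := by
  obtain ⟨-, γ, hne, hc, hmx⟩ := hm
  have hs := θ.sep
  have hγ : ∀ x ∈ T, x ≠ θ → ¬ CrossZ γ x := fun x hx hxe =>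
    hc γ (Or.inr rfl) x (Or.inl ⟨hx, hxe⟩)
  have hcr : CrossZ γ θ := by
    by_contra hcr
    have : θ ∈ (T \ {θ}) ∪ {γ} := by
      refine hmx θ ?_
      rintro x (⟨hx, -⟩ | rfl)
      · exact hT.1 θ hθ x hx
      · simp only [CrossZ] at *
        omega
    rcases this with h | h
    · exact h.2 rfl
    · exact hne h.symm
  rcases hcr with h | h
  · obtain ⟨p, ⟨x, hx, hx1, hx2⟩, hp⟩ : ∃ p ∈ {p : ℤ | ∃ γ ∈ T, γ.src = p ∧ γ.tgt = θ.src},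
        p < γ.src := by
      by_contra hcon
      push Not at hcon
      refine hL ((Set.finite_Icc γ.src θ.src).subset fun p hp => ⟨hcon p hp, ?_⟩)
      obtain ⟨x, -, h1, h2⟩ := hp
      have := x.sep
      omega
    refine hγ x hx (by rintro rfl; omega) ?_
    simp only [CrossZ]
    omega
  · obtain ⟨p, ⟨x, hx, hx1, hx2⟩, hp⟩ : ∃ p ∈ {p : ℤ | ∃ γ ∈ T, γ.src = θ.tgt ∧ γ.tgt = p},
        γ.tgt < p := by
      by_contra hcon
      push Not at hcon
      refine hR ((Set.finite_Icc θ.tgt γ.tgt).subset fun p hp => ⟨?_, hcon p hp⟩)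
      obtain ⟨x, -, h1, h2⟩ := hp
      have := x.sep
      omega
    refine hγ x hx (by rintro rfl; omega) ?_
    simp only [CrossZ]
    omega

set_option maxHeartbeats 4000000 in
lemma mutable_of {T : Set ArcZ} (hT : IsTriangulationZ T) {θ : ArcZ} (hθ : θ ∈ T)
    (h : (∃ w, NZ T θ.tgt w ∧ NZ T θ.src w) ∨ (∃ w, NZ T w θ.src ∧ NZ T w θ.tgt)) :
    IsMutableZ T θ := by
  obtain ⟨v, hv1, hv2⟩ := inner_vertex hT hθ
  have a1 := hv1.1
  have a2 := hv2.1
  rcases h with ⟨w, hw1, hw2⟩ | ⟨w, hw1, hw2⟩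
  · have a3 := hw1.1
    refine mut_of hT (γ := ⟨v, w, by omega⟩) hθ ?_ ?_ ?_
    · simp only [CrossZ]; omega
    · intro x hx hc
      have b1 := hv1.2 x hx
      have b2 := hv2.2 x hx
      have b3 := hw1.2 x hx
      have b4 := hw2.2 x hx
      simp only [CrossZ] at hc
      rcases hc with hc | hc <;> apply ArcZ_eq <;> omega
    · intro δ hc hδ hδγ
      have b1 := NZ_compat hT hδ hv1 (by omega)
      have b2 := NZ_compat hT hδ hv2 (by omega)
      have b3 := NZ_compat hT hδ hw1 (by omega)
      have b4 := NZ_compat hT hδ hw2 (by omega)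
      simp only [CrossZ] at hc hδγ
      rcases hc with hc | hc <;> apply ArcZ_eq <;> dsimp only <;> omega
  · have a3 := hw1.1
    refine mut_of hT (γ := ⟨w, v, by omega⟩) hθ ?_ ?_ ?_
    · simp only [CrossZ]; omega
    · intro x hx hc
      have b1 := hv1.2 x hx
      have b2 := hv2.2 x hx
      have b3 := hw1.2 x hx
      have b4 := hw2.2 x hx
      simp only [CrossZ] at hc
      rcases hc with hc | hc <;> apply ArcZ_eq <;> omega
    · intro δ hc hδ hδγ
      have b1 := NZ_compat hT hδ hv1 (by omega)
      have b2 := NZ_compat hT hδ hv2 (by omega)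
      have b3 := NZ_compat hT hδ hw1 (by omega)
      have b4 := NZ_compat hT hδ hw2 (by omega)
      simp only [CrossZ] at hc hδγ
      rcases hc with hc | hc <;> apply ArcZ_eq <;> dsimp only <;> omega

/-- An arc `θ = (a,b)` of a triangulation `T` of the ∞-gon is mutable if and only if it is
not the case that `T` has both a left fountain at `a` and a right fountain at `b`. -/
theorem statement4 (T : Set ArcZ) (hT : IsTriangulationZ T) (θ : ArcZ) (hθ : θ ∈ T) :
    IsMutableZ T θ ↔ ¬ (LeftFountainZ T θ.src ∧ RightFountainZ T θ.tgt) := by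
  constructor
  · rintro hm ⟨hL, hR⟩
    exact not_mutable hT hθ hm hL hR
  · intro h
    apply mutable_of hT hθ
    by_cases hL : LeftFountainZ T θ.src
    · exact outer_right hT (NZ_of_mem hT hθ) fun hR => h ⟨hL, hR⟩
    · exact outer_left hT (NZ_of_mem hT hθ) hL
end
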